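/- arXiv:1811.09765 — 8 statements merged into one kernel-verified Lean document; each statement's English description precedes it below -/
import Mathlib

section
/- Let M be a topological space and ≺ a relation on M that is closed and transitive. Let x ∈ M, let (yᵢ) be a ≺-increasing sequence (yᵢ ≺ yᵢ₊₁ for all i), let B ⊆ M be a compact set, and suppose there are points zᵢ ∈ B with yᵢ ≺ zᵢ ≺ x for all i. Then there exists a point z∞ ∈ B such that z∞ ≺ x and yᵢ ≺ z∞ for all i. -/
/-- A relation `r` on a topological space is topologically closed if its graph is closed
in the product topology. -/
def ClosedRel {M : Type*} [TopologicalSpace M] (r : M → M → Prop) : Prop :=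
  IsClosed {p : M × M | r p.1 p.2}

/-- If `≺` is closed and transitive, `(yᵢ)` is `≺`-increasing, `B` is compact, and there are
`zᵢ ∈ B` with `yᵢ ≺ zᵢ ≺ x`, then some `z∞ ∈ B` satisfies `z∞ ≺ x` and `yᵢ ≺ z∞` for all `i`. -/
theorem compact_accumulation_of_relation
    {M : Type*} [TopologicalSpace M] (r : M → M → Prop)
    (hclosed : ClosedRel r) (htrans : Transitive r)
    (x : M) (y : ℕ → M) (hinc : ∀ i, r (y i) (y (i + 1)))
    (B : Set M) (hB : IsCompact B)
    (z : ℕ → M) (hzB : ∀ i, z i ∈ B)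
    (hyz : ∀ i, r (y i) (z i)) (hzx : ∀ i, r (z i) x) :
    ∃ zinf ∈ B, r zinf x ∧ ∀ i, r (y i) zinf := by
  obtain ⟨a, haB, ha⟩ := hB.exists_mapClusterPt_of_frequently (f := z) (l := Filter.atTop)
    (Filter.Eventually.of_forall hzB).frequently
  have mem_of_eventually {S : Set M} (hS : IsClosed S)
      (h : ∀ᶠ k in Filter.atTop, z k ∈ S) : a ∈ S :=
    isClosed_iff_clusterPt.mp hS a (ClusterPt.mono ha (Filter.le_principal_iff.mpr h))
  have hlt : ∀ i k, i < k → r (y i) (y k) := fun i k hik => by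
    induction k, hik using Nat.le_induction with
    | base => exact hinc i
    | succ k _ ih => exact htrans ih (hinc k)
  refine ⟨a, haB, ?_, fun i => ?_⟩
  · exact mem_of_eventually (S := {w | r w x})
      (hclosed.preimage (by fun_prop : Continuous fun w : M => (w, x)))
      (Filter.Eventually.of_forall hzx)
  · refine mem_of_eventually (S := {w | r (y i) w})
      (hclosed.preimage (by fun_prop : Continuous fun w : M => (y i, w))) ?_
    filter_upwards [Filter.eventually_gt_atTop i] with k hk
    exact htrans (hlt i k hk) (hyz k)
end

section
/- Let M be a locally compact Hausdorff topological space and ≺ a relation on M that is reflexive, transitive, antisymmetric, and topologically closed. Assume: (local K-convexity) for every x ∈ M and every open set U containing x there is a K-convex open set V with x ∈ V ⊆ U; and (interpolation) for every subset S ⊆ M whose topological frontier Fr(S) is compact, whenever x ≺ y with exactly one of x, y belonging to S, there exists w ∈ Fr(S) with x ≺ w ≺ y. Then for any ≺-increasing sequence (yᵢ) (yᵢ ≺ yᵢ₊₁ for all i) and any x ∈ M that is a supremum of {yᵢ} with respect to ≺, the sequence (yᵢ) converges to x in the topology of M. -/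
/-- The causal future `K⁺(p) = {q | p ≺ q}`. -/
def KPlus {M : Type*} (r : M → M → Prop) (p : M) : Set M := {q | r p q}

/-- The causal past `K⁻(p) = {q | q ≺ p}`. -/
def KMinus {M : Type*} (r : M → M → Prop) (p : M) : Set M := {q | r q p}

/-- A set `U` is K-convex if it contains the interval `K⁺(a) ∩ K⁻(b)` between any of
its points. -/
def KConvex {M : Type*} (r : M → M → Prop) (U : Set M) : Prop :=
  ∀ a ∈ U, ∀ b ∈ U, ∀ c : M, r a c → r c b → c ∈ U

/-- `x` is a supremum of the set `S` with respect to the relation `r`. -/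
def IsSupRel {M : Type*} (r : M → M → Prop) (S : Set M) (x : M) : Prop :=
  (∀ y ∈ S, r y x) ∧ ∀ z : M, (∀ y ∈ S, r y z) → r x z

/-- `x` is an infimum of the set `S` with respect to the relation `r`. -/
def IsInfRel {M : Type*} (r : M → M → Prop) (S : Set M) (x : M) : Prop :=
  (∀ y ∈ S, r x y) ∧ ∀ z : M, (∀ y ∈ S, r z y) → r z x

/-- The order-theoretic boundary `∂K⁺(p)`: points of `K⁺(p)` which are suprema of
`≺`-increasing sequences lying outside `K⁺(p)`. -/
def OrdBoundaryPlus {M : Type*} (r : M → M → Prop) (p : M) : Set M :=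
  {x | x ∈ KPlus r p ∧ ∃ y : ℕ → M, (∀ i, r (y i) (y (i + 1))) ∧
    (∀ i, y i ∉ KPlus r p) ∧ IsSupRel r (Set.range y) x}

/-- The order-theoretic boundary `∂K⁻(q)`: points of `K⁻(q)` which are infima of
`≺`-decreasing sequences lying outside `K⁻(q)`. -/
def OrdBoundaryMinus {M : Type*} (r : M → M → Prop) (q : M) : Set M :=
  {x | x ∈ KMinus r q ∧ ∃ y : ℕ → M, (∀ i, r (y (i + 1)) (y i)) ∧
    (∀ i, y i ∉ KMinus r q) ∧ IsInfRel r (Set.range y) x}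

/-- Along an increasing sequence for a reflexive transitive relation, earlier terms precede
later ones. -/
theorem rel_of_le_of_rel_succ {M : Type*} {r : M → M → Prop} (hrefl : ∀ a, r a a)
    (htrans : ∀ a b c, r a b → r b c → r a c) {y : ℕ → M} (hinc : ∀ i, r (y i) (y (i + 1)))
    {n m : ℕ} (hnm : n ≤ m) : r (y n) (y m) := by
  induction m, hnm using Nat.le_induction with
  | base => exact hrefl _
  | succ k _ ih => exact htrans _ _ _ ih (hinc k)

theorem ClosedRel.isClosed_KPlus {M : Type*} [TopologicalSpace M] {r : M → M → Prop}
    (h : ClosedRel r) (p : M) : IsClosed (KPlus r p) :=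
  IsClosed.preimage (f := fun q => (p, q)) (by fun_prop) h

theorem ClosedRel.isClosed_KMinus {M : Type*} [TopologicalSpace M] {r : M → M → Prop}
    (h : ClosedRel r) (p : M) : IsClosed (KMinus r p) :=
  IsClosed.preimage (f := fun q => (q, p)) (by fun_prop) h

theorem IsClosed.mem_of_clusterPt_of_eventually {M ι : Type*} [TopologicalSpace M] {C : Set M}
    (hC : IsClosed C) {l : Filter ι} {u : ι → M} {a : M} (ha : ClusterPt a (l.map u))
    (hu : ∀ᶠ i in l, u i ∈ C) : a ∈ C :=
  isClosed_iff_clusterPt.1 hC a (ha.mono (Filter.le_principal_iff.2 hu))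


/-- Lemma 1 of the paper: in a locally compact Hausdorff space with a reflexive, transitive,
antisymmetric, closed relation satisfying local K-convexity and interpolation, order-theoretic
suprema of increasing sequences are also topological limits. -/
theorem sup_is_topological_limit
    {M : Type*} [TopologicalSpace M] [LocallyCompactSpace M] [T2Space M]
    (r : M → M → Prop)
    (hrefl : Reflexive r) (htrans : Transitive r) (hanti : AntiSymmetric r)
    (hclosed : ClosedRel r)
    (hconv : ∀ x : M, ∀ U : Set M, IsOpen U → x ∈ U →
      ∃ V : Set M, IsOpen V ∧ KConvex r V ∧ x ∈ V ∧ V ⊆ U)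
    (hinterp : ∀ S : Set M, IsCompact (frontier S) → ∀ x y : M, r x y →
      Xor' (x ∈ S) (y ∈ S) → ∃ w ∈ frontier S, r x w ∧ r w y)
    (y : ℕ → M) (hinc : ∀ i, r (y i) (y (i + 1)))
    (x : M) (hsup : IsSupRel r (Set.range y) x) :
    Filter.Tendsto y Filter.atTop (nhds x) := by
  have hmono : ∀ {n m : ℕ}, n ≤ m → r (y n) (y m) := fun h =>
    rel_of_le_of_rel_succ (fun a => hrefl a) (fun _ _ _ hab hbc => htrans hab hbc) hinc h
  have hle : ∀ n, r (y n) x := fun n => hsup.1 _ ⟨n, rfl⟩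
  intro U hU
  obtain ⟨K, hKx, hKU, hK⟩ := local_compact_nhds hU
  obtain ⟨V, hVo, hVc, hxV, hVK⟩ :=
    hconv x (interior K) isOpen_interior (mem_interior_iff_mem_nhds.2 hKx)
  replace hVK : V ⊆ K := hVK.trans interior_subset
  by_cases hV : ∃ n, y n ∈ V
  · obtain ⟨n, hn⟩ := hV
    rw [Filter.mem_map]
    filter_upwards [Filter.eventually_ge_atTop n] with m hm
    exact hKU (hVK (hVc _ hn _ hxV _ (hmono hm) (hle m)))
  · push Not at hV
    have hfr : IsCompact (frontier V) :=
      hK.of_isClosed_subset isClosed_frontier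
        (frontier_subset_closure.trans (closure_minimal hVK hK.isClosed))
    choose w hwV hyw hwx using fun n =>
      hinterp V hfr (y n) x (hle n) (Or.inr ⟨hxV, hV n⟩)
    obtain ⟨a, haV, ha⟩ := hfr (f := Filter.atTop.map w)
      (Filter.tendsto_principal.2 (Filter.Eventually.of_forall hwV))
    have hax : r a x := (ClosedRel.isClosed_KMinus hclosed x).mem_of_clusterPt_of_eventually ha
      (Filter.Eventually.of_forall hwx)
    have hya : ∀ n, r (y n) a := fun n =>
      (ClosedRel.isClosed_KPlus hclosed (y n)).mem_of_clusterPt_of_eventually ha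
        ((Filter.eventually_ge_atTop n).mono fun m hm => htrans (hmono hm) (hyw m))
    have hxa : r x a := hsup.2 a (by rintro _ ⟨n, rfl⟩; exact hya n)
    obtain rfl : a = x := hanti hax hxa
    rw [hVo.frontier_eq] at haV
    exact absurd hxV haV.2
end

section
/- Let M be a locally compact Hausdorff topological space and ≺ a relation on M that is reflexive, transitive, antisymmetric, and topologically closed. Assume: (local K-convexity) for every x ∈ M and every open set U containing x there is a K-convex open set V with x ∈ V ⊆ U; and (interpolation) for every subset S ⊆ M whose topological frontier Fr(S) is compact, whenever x ≺ y with exactly one of x, y belonging to S, there exists w ∈ Fr(S) with x ≺ w ≺ y. Then for every p ∈ M, the order-theoretic boundary ∂K⁺(p) is contained in the topological frontier Fr(K⁺(p)) of the set K⁺(p). -/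
/-- One inclusion of the paper's Theorem 1: the order-theoretic boundary `∂K⁺(p)` is contained
in the topological frontier of `K⁺(p)`. -/
theorem ordBoundary_subset_frontier
    {M : Type*} [TopologicalSpace M] [LocallyCompactSpace M] [T2Space M]
    (r : M → M → Prop)
    (hrefl : Reflexive r) (htrans : Transitive r) (hanti : AntiSymmetric r)
    (hclosed : ClosedRel r)
    (hconv : ∀ x : M, ∀ U : Set M, IsOpen U → x ∈ U →
      ∃ V : Set M, IsOpen V ∧ KConvex r V ∧ x ∈ V ∧ V ⊆ U)
    (hinterp : ∀ S : Set M, IsCompact (frontier S) → ∀ x y : M, r x y →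
      Xor' (x ∈ S) (y ∈ S) → ∃ w ∈ frontier S, r x w ∧ r w y)
    (p : M) :
    OrdBoundaryPlus r p ⊆ frontier (KPlus r p) := by
  rintro x ⟨hpx, y, hmono, hy, hle, hleast⟩
  refine ⟨subset_closure hpx, fun hx => ?_⟩
  obtain ⟨C, hC, hxC, hCsub⟩ := exists_compact_subset isOpen_interior hx
  have hfr : IsCompact (frontier C) :=
    hC.of_isClosed_subset isClosed_frontier hC.isClosed.frontier_subset
  have hex : ∀ i, ∃ w ∈ frontier C, r (y i) w ∧ r w x := fun i =>
    hinterp C hfr (y i) x (hle _ ⟨i, rfl⟩)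
      (Or.inr ⟨interior_subset hxC, fun h => hy i (interior_subset (hCsub h))⟩)
  choose w hw hyw hwx using hex
  obtain ⟨z, hz, hzw⟩ := hfr.exists_mapClusterPt (f := Filter.atTop) (u := w)
    (Filter.le_principal_iff.2 (Filter.mem_map.2 (Filter.Eventually.of_forall hw)))
  have hyy : ∀ i j, i ≤ j → r (y i) (y j) := fun i j hij =>
    Nat.le_induction (hrefl _) (fun n _ ih => htrans ih (hmono n)) j hij
  have hyz : ∀ i, r (y i) z := fun i =>
    (hclosed.preimage (f := fun b => (y i, b)) (by fun_prop)).mem_of_mapClusterPt hzw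
      (Filter.eventually_atTop.2 ⟨i, fun j hij => htrans (hyy i j hij) (hyw j)⟩)
  have hzx : r z x :=
    (hclosed.preimage (f := fun b => (b, x)) (by fun_prop)).mem_of_mapClusterPt hzw
      (Filter.Eventually.of_forall hwx)
  have hxz : r x z := hleast z (by rintro _ ⟨i, rfl⟩; exact hyz i)
  obtain rfl := hanti hxz hzx
  exact hz.2 hxC
end

section
/- Let M be a topological space, ≺ a relation on M that is reflexive, transitive, and topologically closed, and ≪ a further relation on M such that: x ≪ y implies x ≺ y; for every z ∈ M the set I⁺(z) = {w ∈ M : z ≪ w} is open; and (past approximation) every x ∈ M is the topological limit of some sequence (yᵢ) with yᵢ ≪ yᵢ₊₁ and yᵢ ≪ x for all i. Then for every p ∈ M, the topological frontier Fr(K⁺(p)) of K⁺(p) is contained in the order-theoretic boundary ∂K⁺(p). -/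
/-- The limit of a sequence all of whose terms lie below `z` lies below `z`. -/
theorem ClosedRel.rel_of_tendsto {M : Type*} [TopologicalSpace M] {r : M → M → Prop}
    (h : ClosedRel r) {y : ℕ → M} {x z : M} (hy : Filter.Tendsto y Filter.atTop (nhds x))
    (hz : ∀ n, r (y n) z) : r x z :=
  (IsClosed.preimage (Continuous.prodMk_left z) h).mem_of_tendsto hy (.of_forall hz)

/-- The chronological future of a point of `K⁺(p)` lies in the interior of `K⁺(p)`. -/
theorem mem_interior_KPlus {M : Type*} [TopologicalSpace M] {r i : M → M → Prop}
    (htrans : ∀ ⦃a b c : M⦄, r a b → r b c → r a c) (hsub : ∀ x y : M, i x y → r x y)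
    (hopen : ∀ z : M, IsOpen {w : M | i z w}) {p z x : M} (hz : z ∈ KPlus r p) (hzx : i z x) :
    x ∈ interior (KPlus r p) :=
  interior_maximal (fun w hw => htrans hz (hsub z w hw)) (hopen z) hzx

/-- The second inclusion of the paper's Theorem 1: the topological frontier of `K⁺(p)` is
contained in the order-theoretic boundary `∂K⁺(p)`. -/
theorem frontier_subset_ordBoundary
    {M : Type*} [TopologicalSpace M]
    (r : M → M → Prop) (i : M → M → Prop)
    (hrefl : Reflexive r) (htrans : Transitive r) (hclosed : ClosedRel r)
    (hsub : ∀ x y : M, i x y → r x y)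
    (hopen : ∀ z : M, IsOpen {w : M | i z w})
    (happrox : ∀ x : M, ∃ y : ℕ → M, (∀ n, i (y n) (y (n + 1))) ∧ (∀ n, i (y n) x) ∧
      Filter.Tendsto y Filter.atTop (nhds x))
    (p : M) :
    frontier (KPlus r p) ⊆ OrdBoundaryPlus r p := by
  intro x hx
  rw [(hclosed.isClosed_KPlus p).frontier_eq] at hx
  obtain ⟨y, hmono, hyx, hlim⟩ := happrox x
  refine ⟨hx.1, y, fun n => hsub _ _ (hmono n), fun n hn => ?_, ?_, fun z hz => ?_⟩
  · exact hx.2 (mem_interior_KPlus htrans hsub hopen hn (hyx n))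
  · rintro _ ⟨n, rfl⟩
    exact hsub _ _ (hyx n)
  · exact hclosed.rel_of_tendsto hlim fun n => hz _ ⟨n, rfl⟩
end

section
/- Let M be a locally compact Hausdorff topological space, ≺ a relation on M that is reflexive, transitive, antisymmetric, and topologically closed, and ≪ a further relation on M. Assume: (local K-convexity) for every x ∈ M and every open set U containing x there is a K-convex open set V with x ∈ V ⊆ U; (interpolation) for every subset S ⊆ M whose topological frontier Fr(S) is compact, whenever x ≺ y with exactly one of x, y belonging to S, there exists w ∈ Fr(S) with x ≺ w ≺ y; x ≪ y implies x ≺ y; for every z ∈ M the set I⁺(z) = {w ∈ M : z ≪ w} is open; and (past approximation) every x ∈ M is the topological limit of some sequence (yᵢ) with yᵢ ≪ yᵢ₊₁ and yᵢ ≪ x for all i. Then for every p ∈ M, the order-theoretic boundary ∂K⁺(p) equals the topological frontier Fr(K⁺(p)) of K⁺(p). -/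
open Filter Topology in
/-- For a closed relation satisfying frontier interpolation, the supremum of an increasing sequence
lying outside a set `S` is not in the interior of `S`. -/
theorem IsSupRel.notMem_interior {M : Type*} [TopologicalSpace M] [LocallyCompactSpace M]
    [T2Space M] {r : M → M → Prop} (hrefl : Reflexive r) (htrans : Transitive r)
    (hanti : AntiSymmetric r) (hclosed : ClosedRel r)
    (hinterp : ∀ S : Set M, IsCompact (frontier S) → ∀ x y : M, r x y →
      Xor' (x ∈ S) (y ∈ S) → ∃ w ∈ frontier S, r x w ∧ r w y)
    {y : ℕ → M} (hmono : ∀ n, r (y n) (y (n + 1))) {x : M} (hx : IsSupRel r (Set.range y) x)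
    {S : Set M} (hy : ∀ n, y n ∉ S) : x ∉ interior S := by
  intro hxS
  obtain ⟨N, hN, hxN, hNS⟩ := exists_compact_subset isOpen_interior hxS
  have hfrontier : IsCompact (frontier (interior N)) :=
    hN.of_isClosed_subset isClosed_frontier <|
      frontier_subset_closure.trans <| closure_minimal interior_subset hN.isClosed
  have hyx (n : ℕ) : r (y n) x := hx.1 _ ⟨n, rfl⟩
  have hyN (n : ℕ) : y n ∉ interior N := fun h =>
    hy n (interior_subset (hNS (interior_subset h)))
  choose w hw hyw hwx using fun n =>
    hinterp _ hfrontier (y n) x (hyx n) (Or.inr ⟨hxN, hyN n⟩)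
  obtain ⟨a, ha, hcluster⟩ := hfrontier.exists_mapClusterPt (u := w) (f := atTop)
    (le_principal_iff.2 <| mem_map.2 <| Eventually.of_forall hw)
  have mem_of_eventually {C : Set M} (hC : IsClosed C) (h : ∀ᶠ n in atTop, w n ∈ C) : a ∈ C :=
    isClosed_iff_clusterPt.1 hC a (ClusterPt.mono hcluster (le_principal_iff.2 h))
  have hle {k : ℕ} (n : ℕ) (hn : k ≤ n) : r (y k) (y n) := by
    induction n, hn using Nat.le_induction with
    | base => exact hrefl _
    | succ n _ ih => exact htrans ih (hmono n)
  have hay (k : ℕ) : r (y k) a := by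
    refine mem_of_eventually (C := {z | r (y k) z})
      (hclosed.preimage (f := fun z => (y k, z)) (by fun_prop)) ?_
    filter_upwards [eventually_ge_atTop k] with n hn
    exact htrans (hle n hn) (hyw n)
  have hax : r a x := mem_of_eventually (C := {z | r z x})
    (hclosed.preimage (f := fun z => (z, x)) (by fun_prop)) (Eventually.of_forall hwx)
  have hxa : r x a := hx.2 a (by rintro _ ⟨k, rfl⟩; exact hay k)
  have hxe : x = a := hanti hxa hax
  rw [isOpen_interior.frontier_eq] at ha
  exact ha.2 (hxe ▸ hxN)

/-- If a sequence converges to one of its upper bounds for a closed relation, then this limit is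
its supremum. -/
theorem ClosedRel.isSupRel_of_tendsto {M : Type*} [TopologicalSpace M] {r : M → M → Prop}
    (hclosed : ClosedRel r) {y : ℕ → M} {x : M} (hyx : ∀ n, r (y n) x)
    (hlim : Filter.Tendsto y Filter.atTop (nhds x)) : IsSupRel r (Set.range y) x := by
  refine ⟨by rintro _ ⟨n, rfl⟩; exact hyx n, fun z hz => ?_⟩
  have hz_closed : IsClosed {a | r a z} :=
    hclosed.preimage (f := fun a => (a, z)) (by fun_prop)
  exact hz_closed.mem_of_tendsto hlim (Filter.Eventually.of_forall fun n => hz _ ⟨n, rfl⟩)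

/-- The paper's Theorem 1: the order-theoretic boundary of `K⁺(p)` coincides with its
topological frontier. -/
theorem ordBoundary_eq_frontier
    {M : Type*} [TopologicalSpace M] [LocallyCompactSpace M] [T2Space M]
    (r : M → M → Prop) (i : M → M → Prop)
    (hrefl : Reflexive r) (htrans : Transitive r) (hanti : AntiSymmetric r)
    (hclosed : ClosedRel r)
    (hconv : ∀ x : M, ∀ U : Set M, IsOpen U → x ∈ U →
      ∃ V : Set M, IsOpen V ∧ KConvex r V ∧ x ∈ V ∧ V ⊆ U)
    (hinterp : ∀ S : Set M, IsCompact (frontier S) → ∀ x y : M, r x y →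
      Xor' (x ∈ S) (y ∈ S) → ∃ w ∈ frontier S, r x w ∧ r w y)
    (hsub : ∀ x y : M, i x y → r x y)
    (hopen : ∀ z : M, IsOpen {w : M | i z w})
    (happrox : ∀ x : M, ∃ y : ℕ → M, (∀ n, i (y n) (y (n + 1))) ∧ (∀ n, i (y n) x) ∧
      Filter.Tendsto y Filter.atTop (nhds x))
    (p : M) :
    OrdBoundaryPlus r p = frontier (KPlus r p) := by
  have hK : IsClosed (KPlus r p) := hclosed.preimage (f := fun z => (p, z)) (by fun_prop)
  rw [hK.frontier_eq]
  ext x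
  refine and_congr_right fun _ => ⟨?_, fun hx => ?_⟩
  · rintro ⟨y, hmono, hy, hsup⟩
    exact hsup.notMem_interior hrefl htrans hanti hclosed hinterp hmono hy
  · obtain ⟨y, hmono, hyx, hlim⟩ := happrox x
    refine ⟨y, fun n => hsub _ _ (hmono n), fun n hn => hx ?_,
      hclosed.isSupRel_of_tendsto (fun n => hsub _ _ (hyx n)) hlim⟩
    exact mem_interior.2
      ⟨{w | i (y n) w}, fun w hw => htrans hn (hsub _ _ hw), hopen (y n), hyx n⟩
end

section
/- Let M be a locally compact Hausdorff topological space, ≺ a relation on M that is reflexive, transitive, antisymmetric, and topologically closed, and ≪ a further relation on M. Assume: (local K-convexity) for every x ∈ M and every open set U containing x there is a K-convex open set V with x ∈ V ⊆ U; (interpolation) for every subset S ⊆ M whose topological frontier Fr(S) is compact, whenever x ≺ y with exactly one of x, y belonging to S, there exists w ∈ Fr(S) with x ≺ w ≺ y; x ≪ y implies x ≺ y; for every z ∈ M the set I⁺(z) = {w ∈ M : z ≪ w} is open; and (past approximation) every x ∈ M is the topological limit of some sequence (yᵢ) with yᵢ ≪ yᵢ₊₁ and yᵢ ≪ x for all i.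 Then for every p ∈ M, the set A⁺(p) = K⁺(p) \ ∂K⁺(p) equals the topological interior of K⁺(p); in particular A⁺(p) is open. -/
theorem ClosedRel.isClosed_right {M : Type*} [TopologicalSpace M] {r : M → M → Prop}
    (hr : ClosedRel r) (a : M) : IsClosed {z | r a z} :=
  IsClosed.preimage (f := fun z : M => (a, z)) (by fun_prop) hr

theorem ClosedRel.isClosed_left {M : Type*} [TopologicalSpace M] {r : M → M → Prop}
    (hr : ClosedRel r) (b : M) : IsClosed {z | r z b} :=
  IsClosed.preimage (f := fun z : M => (z, b)) (by fun_prop) hr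

/-- The supremum of an increasing sequence lies in the closure of its range. -/
theorem IsSupRel.mem_closure_range {M : Type*} [TopologicalSpace M] [LocallyCompactSpace M]
    [T2Space M] {r : M → M → Prop} (hrefl : ∀ a, r a a)
    (htrans : ∀ ⦃a b c⦄, r a b → r b c → r a c) (hanti : ∀ ⦃a b⦄, r a b → r b a → a = b)
    (hclosed : ClosedRel r)
    (hinterp : ∀ S : Set M, IsCompact (frontier S) → ∀ x y : M, r x y →
      Xor (x ∈ S) (y ∈ S) → ∃ w ∈ frontier S, r x w ∧ r w y)
    {y : ℕ → M} {x : M} (hmono : ∀ n, r (y n) (y (n + 1)))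
    (hsup : IsSupRel r (Set.range y) x) : x ∈ closure (Set.range y) := by
  by_contra hx
  obtain ⟨C, hC, hxC, hCy⟩ := exists_compact_subset isClosed_closure.isOpen_compl hx
  have hfr : IsCompact (frontier C) :=
    hC.of_isClosed_subset isClosed_frontier hC.isClosed.frontier_subset
  have hyC : ∀ n, y n ∉ C := fun n hn => hCy hn (subset_closure ⟨n, rfl⟩)
  choose w hw hyw hwx using fun n => hinterp C hfr (y n) x (hsup.1 _ ⟨n, rfl⟩)
    (Or.inr ⟨interior_subset hxC, hyC n⟩)
  obtain ⟨a, ha, hcl⟩ := hfr.exists_clusterPt (f := Filter.map w Filter.atTop)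
    (Filter.tendsto_principal.2 (Filter.Eventually.of_forall hw))
  have hmem : ∀ s : Set M, IsClosed s → (∀ᶠ n in Filter.atTop, w n ∈ s) → a ∈ s :=
    fun s hs hev => hs.closure_eq ▸
      mem_closure_iff_clusterPt.2 (hcl.mono (Filter.le_principal_iff.2 hev))
  have hle : ∀ m n, m ≤ n → r (y m) (y n) := by
    intro m n hmn
    induction n, hmn using Nat.le_induction with
    | base => exact hrefl _
    | succ n _ ih => exact htrans ih (hmono n)
  have hax : r a x :=
    hmem _ (hclosed.isClosed_left x) (Filter.Eventually.of_forall hwx)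
  have hxa : r x a := by
    refine hsup.2 a ?_
    rintro _ ⟨m, rfl⟩
    refine hmem _ (hclosed.isClosed_right (y m)) ?_
    filter_upwards [Filter.eventually_ge_atTop m] with n hn
    exact htrans (hle m n hn) (hyw n)
  obtain rfl : a = x := hanti hax hxa
  exact ha.2 hxC

/-- The paper's Lemma 4: `A⁺(p) = K⁺(p) \ ∂K⁺(p)` equals the topological interior of
`K⁺(p)`; in particular `A⁺(p)` is open. -/
theorem APlus_eq_interior
    {M : Type*} [TopologicalSpace M] [LocallyCompactSpace M] [T2Space M]
    (r : M → M → Prop) (i : M → M → Prop)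
    (hrefl : Reflexive r) (htrans : Transitive r) (hanti : AntiSymmetric r)
    (hclosed : ClosedRel r)
    (hconv : ∀ x : M, ∀ U : Set M, IsOpen U → x ∈ U →
      ∃ V : Set M, IsOpen V ∧ KConvex r V ∧ x ∈ V ∧ V ⊆ U)
    (hinterp : ∀ S : Set M, IsCompact (frontier S) → ∀ x y : M, r x y →
      Xor' (x ∈ S) (y ∈ S) → ∃ w ∈ frontier S, r x w ∧ r w y)
    (hsub : ∀ x y : M, i x y → r x y)
    (hopen : ∀ z : M, IsOpen {w : M | i z w})
    (happrox : ∀ x : M, ∃ y : ℕ → M, (∀ n, i (y n) (y (n + 1))) ∧ (∀ n, i (y n) x) ∧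
      Filter.Tendsto y Filter.atTop (nhds x))
    (p : M) :
    KPlus r p \ OrdBoundaryPlus r p = interior (KPlus r p) ∧
      IsOpen (KPlus r p \ OrdBoundaryPlus r p) := by
  suffices h : KPlus r p \ OrdBoundaryPlus r p = interior (KPlus r p) from
    ⟨h, h ▸ isOpen_interior⟩
  ext x
  constructor
  · rintro ⟨hx, hxb⟩
    by_contra hxi
    obtain ⟨y, hmono, hyx, hlim⟩ := happrox x
    refine hxb ⟨hx, y, fun n => hsub _ _ (hmono n), fun n hn => hxi ?_, ?_, fun z hz => ?_⟩
    · exact mem_interior.2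
        ⟨{w | i (y n) w}, fun w hw => htrans hn (hsub _ _ hw), hopen _, hyx n⟩
    · rintro _ ⟨n, rfl⟩
      exact hsub _ _ (hyx n)
    · exact (hclosed.isClosed_left z).mem_of_tendsto hlim
        (Filter.Eventually.of_forall fun n => hz _ ⟨n, rfl⟩)
  · refine fun hx => ⟨interior_subset hx, ?_⟩
    rintro ⟨-, y, hmono, hy, hsup⟩
    obtain ⟨_, hyK, n, rfl⟩ := mem_closure_iff.1
      (hsup.mem_closure_range hrefl htrans hanti hclosed hinterp hmono) _ isOpen_interior hx
    exact hy n (interior_subset hyK)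
end

section
/- Let M be a locally compact Hausdorff topological space, ≺ a relation on M that is reflexive, transitive, antisymmetric, and topologically closed, and ≪ a further relation on M with x ≪ y ⟹ x ≺ y and with all sets I⁺(z) = {w : z ≪ w} and I⁻(z) = {w : w ≪ z} open. Assume the local K-convexity and interpolation properties, the past approximation property (every x ∈ M is the topological limit of a sequence (yᵢ) with yᵢ ≪ yᵢ₊₁ and yᵢ ≪ x for all i), and its time reverse (every x ∈ M is the topological limit of a sequence (yᵢ) with yᵢ₊₁ ≪ yᵢ and x ≪ yᵢ for all i). Then for all p, q ∈ M the set A(p,q) = A⁺(p) ∩ A⁻(q) is open in M, where A⁺(p) = K⁺(p) \ ∂K⁺(p) and A⁻(q) = K⁻(q) \ ∂K⁻(q). -/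
open Filter Topology in
/-- An increasing sequence converges to its supremum. -/
theorem IsSupRel.tendsto
    {M : Type*} [TopologicalSpace M] [LocallyCompactSpace M] [T2Space M]
    {r : M → M → Prop} (htrans : Transitive r) (hanti : AntiSymmetric r)
    (hclosed : ClosedRel r)
    (hconv : ∀ x : M, ∀ U : Set M, IsOpen U → x ∈ U →
      ∃ V : Set M, IsOpen V ∧ KConvex r V ∧ x ∈ V ∧ V ⊆ U)
    (hinterp : ∀ S : Set M, IsCompact (frontier S) → ∀ x y : M, r x y →
      Xor' (x ∈ S) (y ∈ S) → ∃ w ∈ frontier S, r x w ∧ r w y)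
    {z : ℕ → M} (hz : ∀ n, r (z n) (z (n + 1))) {x : M} (hx : IsSupRel r (Set.range z) x)
    (hrefl : Reflexive r) : Tendsto z atTop (𝓝 x) := by
  have hmono : ∀ m n, m ≤ n → r (z m) (z n) := fun m n h =>
    Nat.le_induction (hrefl _) (fun k _ ih => htrans ih (hz k)) n h
  have hle : ∀ n, r (z n) x := fun n => hx.1 _ ⟨n, rfl⟩
  rw [tendsto_nhds]
  intro U hU hxU
  obtain ⟨K, hK, hxK, hKU⟩ := exists_compact_subset hU hxU
  obtain ⟨V, hV, hVconv, hxV, hVK⟩ := hconv x (interior K) isOpen_interior hxK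
  have hVK' : V ⊆ K := hVK.trans interior_subset
  suffices h : ∃ N, z N ∈ V by
    obtain ⟨N, hN⟩ := h
    filter_upwards [eventually_ge_atTop N] with n hn
    exact hKU (hVK' (hVconv _ hN _ hxV _ (hmono N n hn) (hle n)))
  by_contra! hout
  have hcomp : IsCompact (frontier V) :=
    hK.of_isClosed_subset isClosed_frontier
      (frontier_subset_closure.trans (closure_minimal hVK' hK.isClosed))
  choose w hwV hzw hwx using fun n =>
    hinterp V hcomp (z n) x (hle n) (Or.inr ⟨hxV, hout n⟩)
  obtain ⟨c, hcV, hc⟩ := hcomp.exists_mapClusterPt (u := w) (f := atTop)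
    (tendsto_principal.2 (Eventually.of_forall hwV))
  have hcx : r c x := by
    have hcl : IsClosed {v | r v x} := hclosed.preimage (by fun_prop : Continuous fun v => (v, x))
    exact hcl.mem_of_mapClusterPt hc (Eventually.of_forall hwx)
  have hzc : ∀ m, r (z m) c := by
    intro m
    have hcl : IsClosed {v | r (z m) v} :=
      hclosed.preimage (by fun_prop : Continuous fun v => (z m, v))
    refine hcl.mem_of_mapClusterPt hc ?_
    filter_upwards [eventually_ge_atTop m] with n hn
    exact htrans (hmono m n hn) (hzw n)
  have hxc : x = c := hanti (hx.2 c (by rintro _ ⟨m, rfl⟩; exact hzc m)) hcx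
  rw [hV.frontier_eq] at hcV
  exact hcV.2 (hxc ▸ hxV)

open Filter Topology in
/-- The set `A⁺(p) = K⁺(p) \ ∂K⁺(p)` is open. -/
theorem isOpen_KPlus_diff_OrdBoundaryPlus
    {M : Type*} [TopologicalSpace M] [LocallyCompactSpace M] [T2Space M]
    (r : M → M → Prop) (i : M → M → Prop)
    (hrefl : Reflexive r) (htrans : Transitive r) (hanti : AntiSymmetric r)
    (hclosed : ClosedRel r)
    (hconv : ∀ x : M, ∀ U : Set M, IsOpen U → x ∈ U →
      ∃ V : Set M, IsOpen V ∧ KConvex r V ∧ x ∈ V ∧ V ⊆ U)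
    (hinterp : ∀ S : Set M, IsCompact (frontier S) → ∀ x y : M, r x y →
      Xor' (x ∈ S) (y ∈ S) → ∃ w ∈ frontier S, r x w ∧ r w y)
    (hsub : ∀ x y : M, i x y → r x y)
    (hopen : ∀ z : M, IsOpen {w : M | i z w})
    (happrox : ∀ x : M, ∃ y : ℕ → M, (∀ n, i (y n) (y (n + 1))) ∧ (∀ n, i (y n) x) ∧
      Tendsto y atTop (𝓝 x))
    (p : M) : IsOpen (KPlus r p \ OrdBoundaryPlus r p) := by
  rw [isOpen_iff_mem_nhds]
  rintro x ⟨hpx, hx⟩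
  obtain ⟨y, hy, hyx, hlim⟩ := happrox x
  have hsup : IsSupRel r (Set.range y) x := by
    refine ⟨by rintro _ ⟨n, rfl⟩; exact hsub _ _ (hyx n), fun z hz => ?_⟩
    have hcl : IsClosed {v | r v z} := hclosed.preimage (by fun_prop : Continuous fun v => (v, z))
    exact hcl.mem_of_tendsto hlim (Eventually.of_forall fun n => hz _ ⟨n, rfl⟩)
  obtain ⟨n, hn⟩ : ∃ n, r p (y n) := by
    by_contra! hout
    exact hx ⟨hpx, y, fun n => hsub _ _ (hy n), hout, hsup⟩
  filter_upwards [(hopen (y n)).mem_nhds (hyx n)] with w hw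
  refine ⟨htrans hn (hsub _ _ hw), ?_⟩
  rintro ⟨-, z, hz, hzout, hzsup⟩
  have hzw := hzsup.tendsto htrans hanti hclosed hconv hinterp hz hrefl
  obtain ⟨m, hm⟩ := (hzw.eventually ((hopen (y n)).mem_nhds hw)).exists
  exact hzout m (htrans hn (hsub _ _ hm))

/-- The sets `A(p,q) = A⁺(p) ∩ A⁻(q)`, with `A⁺(p) = K⁺(p) \ ∂K⁺(p)` and
`A⁻(q) = K⁻(q) \ ∂K⁻(q)`, are open. -/
theorem A_interval_isOpen
    {M : Type*} [TopologicalSpace M] [LocallyCompactSpace M] [T2Space M]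
    (r : M → M → Prop) (i : M → M → Prop)
    (hrefl : Reflexive r) (htrans : Transitive r) (hanti : AntiSymmetric r)
    (hclosed : ClosedRel r)
    (hconv : ∀ x : M, ∀ U : Set M, IsOpen U → x ∈ U →
      ∃ V : Set M, IsOpen V ∧ KConvex r V ∧ x ∈ V ∧ V ⊆ U)
    (hinterp : ∀ S : Set M, IsCompact (frontier S) → ∀ x y : M, r x y →
      Xor' (x ∈ S) (y ∈ S) → ∃ w ∈ frontier S, r x w ∧ r w y)
    (hsub : ∀ x y : M, i x y → r x y)
    (hopenPlus : ∀ z : M, IsOpen {w : M | i z w})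
    (hopenMinus : ∀ z : M, IsOpen {w : M | i w z})
    (happroxPast : ∀ x : M, ∃ y : ℕ → M, (∀ n, i (y n) (y (n + 1))) ∧ (∀ n, i (y n) x) ∧
      Filter.Tendsto y Filter.atTop (nhds x))
    (happroxFuture : ∀ x : M, ∃ y : ℕ → M, (∀ n, i (y (n + 1)) (y n)) ∧ (∀ n, i x (y n)) ∧
      Filter.Tendsto y Filter.atTop (nhds x))
    (p q : M) :
    IsOpen ((KPlus r p \ OrdBoundaryPlus r p) ∩ (KMinus r q \ OrdBoundaryMinus r q)) := by
  refine (isOpen_KPlus_diff_OrdBoundaryPlus r i hrefl htrans hanti hclosed hconv hinterp hsub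
    hopenPlus happroxPast p).inter ?_
  refine isOpen_KPlus_diff_OrdBoundaryPlus (flip r) (flip i) hrefl
    (fun _ _ _ hab hbc => htrans hbc hab) (fun _ _ hab hba => hanti hba hab)
    (hclosed.preimage continuous_swap) ?_ ?_ (fun x y h => hsub y x h)
    hopenMinus happroxFuture q
  · intro x U hU hx
    obtain ⟨V, hV, hVconv, hxV, hVU⟩ := hconv x U hU hx
    exact ⟨V, hV, fun a ha b hb c hac hcb => hVconv b hb a ha c hcb hac, hxV, hVU⟩
  · intro S hS x y hxy hxor
    obtain ⟨w, hw, hyw, hwx⟩ := hinterp S hS y x hxy hxor.symm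
    exact ⟨w, hw, hwx, hyw⟩
end

section
/- Let M be a locally compact Hausdorff topological space, ≺ a relation on M that is reflexive, transitive, antisymmetric, and topologically closed, and ≪ a further relation on M with x ≪ y ⟹ x ≺ y and with all sets I⁺(z) = {w : z ≪ w} and I⁻(z) = {w : w ≪ z} open. Assume: the local K-convexity and interpolation properties; the past approximation property and its time reverse; (Alexandrov basis property) for every x ∈ M and every open set U containing x there exist p, q ∈ U with x ∈ I⁺(p) ∩ I⁻(q) ⊆ U; and (local coincidence) every point of M has an open K-convex neighborhood W such that for all p, q ∈ W, int(K⁺(p)) ∩ W = I⁺(p) ∩ W and int(K⁻(q)) ∩ W = I⁻(q) ∩ W. Then the family of sets {A(p,q) : p, q ∈ M}, where A(p,q) = A⁺(p) ∩ A⁻(q) with A⁺(p) = K⁺(p) \ ∂K⁺(p) and A⁻(q) = K⁻(q) \ ∂K⁻(q), is a basis for the topology of M: every open subset of M is a union of sets of the form A(p,q). -/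
/-- If `x` is the supremum of an increasing sequence `y`, then `y` meets every compact
neighbourhood of `x`. -/
lemma IsSupRel.exists_mem_of_isCompact {M : Type*} [TopologicalSpace M] [T2Space M]
    {r : M → M → Prop} (htrans : Transitive r) (hanti : AntiSymmetric r) (hclosed : ClosedRel r)
    (hinterp : ∀ S : Set M, IsCompact (frontier S) → ∀ x y : M, r x y →
      Xor' (x ∈ S) (y ∈ S) → ∃ w ∈ frontier S, r x w ∧ r w y)
    (hrefl : Reflexive r) {y : ℕ → M} (hy : ∀ n, r (y n) (y (n + 1))) {x : M}
    (hx : IsSupRel r (Set.range y) x) {S : Set M} (hS : IsCompact S) (hxS : S ∈ nhds x) :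
    ∃ n, y n ∈ S := by
  by_contra! hout
  have hfr : IsCompact (frontier S) :=
    hS.of_isClosed_subset isClosed_frontier hS.isClosed.frontier_subset
  have hmono : ∀ {m n : ℕ}, m ≤ n → r (y m) (y n) := by
    intro m n hmn
    induction hmn with
    | refl => exact hrefl _
    | step _ ih => exact htrans ih (hy _)
  have hyx (n : ℕ) : r (y n) x := hx.1 _ ⟨n, rfl⟩
  have hcl (n : ℕ) : IsClosed {w | r (y n) w ∧ r w x} :=
    (hclosed.preimage (by fun_prop : Continuous fun w => (y n, w))).inter
      (hclosed.preimage (by fun_prop : Continuous fun w => (w, x)))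
  obtain ⟨w, hw⟩ := IsCompact.nonempty_iInter_of_sequence_nonempty_isCompact_isClosed
    (fun n => frontier S ∩ {w | r (y n) w ∧ r w x})
    (fun n w hw => ⟨hw.1, htrans (hy n) hw.2.1, hw.2.2⟩)
    (fun n => by
      obtain ⟨w, hw, h⟩ := hinterp S hfr (y n) x (hyx n) (Or.inr ⟨mem_of_mem_nhds hxS, hout n⟩)
      exact ⟨w, hw, h⟩)
    (hfr.inter_right (hcl 0)) (fun n => isClosed_frontier.inter (hcl n))
  rw [Set.mem_iInter] at hw
  have hwx : w = x := by
    refine hanti (hw 0).2.2 (hx.2 w ?_)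
    rintro _ ⟨n, rfl⟩
    exact (hw n).2.1
  exact (hwx ▸ (hw 0).1).2 (mem_interior_iff_mem_nhds.2 hxS)

/-- The points of `K⁺(p)` off its order-theoretic boundary form its topological interior. -/
lemma KPlus_diff_ordBoundaryPlus {M : Type*} [TopologicalSpace M] [LocallyCompactSpace M]
    [T2Space M] {r i : M → M → Prop}
    (hrefl : Reflexive r) (htrans : Transitive r) (hanti : AntiSymmetric r)
    (hclosed : ClosedRel r)
    (hinterp : ∀ S : Set M, IsCompact (frontier S) → ∀ x y : M, r x y →
      Xor' (x ∈ S) (y ∈ S) → ∃ w ∈ frontier S, r x w ∧ r w y)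
    (hsub : ∀ x y : M, i x y → r x y) (hopen : ∀ z : M, IsOpen {w : M | i z w})
    (happrox : ∀ x : M, ∃ y : ℕ → M, (∀ n, i (y n) (y (n + 1))) ∧ (∀ n, i (y n) x) ∧
      Filter.Tendsto y Filter.atTop (nhds x)) (p : M) :
    KPlus r p \ OrdBoundaryPlus r p = interior (KPlus r p) := by
  ext x
  constructor
  · rintro ⟨hxp, hxb⟩
    by_contra hint
    obtain ⟨y, hy, hyx, hlim⟩ := happrox x
    refine hxb ⟨hxp, y, fun n => hsub _ _ (hy n), fun n hn => hint ?_, ?_, fun z hz => ?_⟩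
    · exact interior_maximal (fun w hw => htrans hn (hsub _ _ hw)) (hopen (y n)) (hyx n)
    · rintro _ ⟨n, rfl⟩
      exact hsub _ _ (hyx n)
    · exact (hclosed.preimage (by fun_prop : Continuous fun w => (w, z))).mem_of_tendsto hlim
        (Filter.Eventually.of_forall fun n => hz _ ⟨n, rfl⟩)
  · refine fun hx => ⟨interior_subset hx, ?_⟩
    rintro ⟨-, y, hy, hout, hsup⟩
    obtain ⟨S, hxS, hSK, hS⟩ := local_compact_nhds (mem_interior_iff_mem_nhds.1 hx)
    obtain ⟨n, hn⟩ := hsup.exists_mem_of_isCompact htrans hanti hclosed hinterp hrefl hy hS hxS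
    exact hout n (hSK hn)

/-- The points of `K⁻(q)` off its order-theoretic boundary form its topological interior. -/
lemma KMinus_diff_ordBoundaryMinus {M : Type*} [TopologicalSpace M] [LocallyCompactSpace M]
    [T2Space M] {r i : M → M → Prop}
    (hrefl : Reflexive r) (htrans : Transitive r) (hanti : AntiSymmetric r)
    (hclosed : ClosedRel r)
    (hinterp : ∀ S : Set M, IsCompact (frontier S) → ∀ x y : M, r x y →
      Xor' (x ∈ S) (y ∈ S) → ∃ w ∈ frontier S, r x w ∧ r w y)
    (hsub : ∀ x y : M, i x y → r x y) (hopen : ∀ z : M, IsOpen {w : M | i w z})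
    (happrox : ∀ x : M, ∃ y : ℕ → M, (∀ n, i (y (n + 1)) (y n)) ∧ (∀ n, i x (y n)) ∧
      Filter.Tendsto y Filter.atTop (nhds x)) (q : M) :
    KMinus r q \ OrdBoundaryMinus r q = interior (KMinus r q) :=
  KPlus_diff_ordBoundaryPlus (r := flip r) (i := flip i) hrefl
    (fun _ _ _ hab hbc => htrans hbc hab) (fun _ _ hab hba => hanti hba hab)
    (hclosed.preimage continuous_swap)
    (fun S hS x y hxy hxor => by
      obtain ⟨w, hw, hyw, hwx⟩ := hinterp S hS y x hxy (Or.symm hxor)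
      exact ⟨w, hw, hwx, hyw⟩)
    (fun x y => hsub y x) hopen happrox q

/-- The paper's Theorem 2: the sets `A(p,q) = (K⁺(p) \ ∂K⁺(p)) ∩ (K⁻(q) \ ∂K⁻(q))` furnish a
basis for the topology of `M`: each is open and every open subset of `M` is a union of such
sets. -/
theorem A_intervals_basis
    {M : Type*} [TopologicalSpace M] [LocallyCompactSpace M] [T2Space M]
    (r : M → M → Prop) (i : M → M → Prop)
    (hrefl : Reflexive r) (htrans : Transitive r) (hanti : AntiSymmetric r)
    (hclosed : ClosedRel r)
    (hconv : ∀ x : M, ∀ U : Set M, IsOpen U → x ∈ U →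
      ∃ V : Set M, IsOpen V ∧ KConvex r V ∧ x ∈ V ∧ V ⊆ U)
    (hinterp : ∀ S : Set M, IsCompact (frontier S) → ∀ x y : M, r x y →
      Xor' (x ∈ S) (y ∈ S) → ∃ w ∈ frontier S, r x w ∧ r w y)
    (hsub : ∀ x y : M, i x y → r x y)
    (hopenPlus : ∀ z : M, IsOpen {w : M | i z w})
    (hopenMinus : ∀ z : M, IsOpen {w : M | i w z})
    (happroxPast : ∀ x : M, ∃ y : ℕ → M, (∀ n, i (y n) (y (n + 1))) ∧ (∀ n, i (y n) x) ∧
      Filter.Tendsto y Filter.atTop (nhds x))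
    (happroxFuture : ∀ x : M, ∃ y : ℕ → M, (∀ n, i (y (n + 1)) (y n)) ∧ (∀ n, i x (y n)) ∧
      Filter.Tendsto y Filter.atTop (nhds x))
    (halex : ∀ x : M, ∀ U : Set M, IsOpen U → x ∈ U →
      ∃ p ∈ U, ∃ q ∈ U, x ∈ {w : M | i p w} ∩ {w : M | i w q} ∧
        {w : M | i p w} ∩ {w : M | i w q} ⊆ U)
    (hloc : ∀ x : M, ∃ W : Set M, IsOpen W ∧ KConvex r W ∧ x ∈ W ∧
      ∀ p ∈ W, ∀ q ∈ W,
        interior (KPlus r p) ∩ W = {w : M | i p w} ∩ W ∧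
        interior (KMinus r q) ∩ W = {w : M | i w q} ∩ W) :
    (∀ p q : M,
      IsOpen ((KPlus r p \ OrdBoundaryPlus r p) ∩ (KMinus r q \ OrdBoundaryMinus r q))) ∧
    ∀ U : Set M, IsOpen U → ∃ F : Set (Set M),
      (∀ V ∈ F, ∃ p q : M,
        V = (KPlus r p \ OrdBoundaryPlus r p) ∩ (KMinus r q \ OrdBoundaryMinus r q)) ∧
      U = ⋃₀ F := by
  simp_rw [KPlus_diff_ordBoundaryPlus hrefl htrans hanti hclosed hinterp hsub hopenPlus happroxPast,
    KMinus_diff_ordBoundaryMinus hrefl htrans hanti hclosed hinterp hsub hopenMinus happroxFuture]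
  refine ⟨fun p q => isOpen_interior.inter isOpen_interior, fun U hU =>
    ⟨{V | V ⊆ U ∧ ∃ p q, V = interior (KPlus r p) ∩ interior (KMinus r q)},
      fun V hV => hV.2, Set.Subset.antisymm (fun x hx => ?_) (Set.sUnion_subset fun V hV => hV.1)⟩⟩
  obtain ⟨V, hV, hVconv, hxV, hVU⟩ := hconv x U hU hx
  obtain ⟨p, hp, q, hq, ⟨hpx, hxq⟩, -⟩ := halex x V hV hxV
  exact ⟨_, ⟨fun w hw => hVU (hVconv p hp q hq w (interior_subset (s := KPlus r p) hw.1)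
      (interior_subset (s := KMinus r q) hw.2)),
    p, q, rfl⟩, interior_maximal (fun w => hsub p w) (hopenPlus p) hpx,
    interior_maximal (fun w => hsub w q) (hopenMinus q) hxq⟩
end
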